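/- Shutdown empties an adapted CP-subnet: let (N,μ₀) be a perpetual free-choice system with regeneration cluster cl, let N̂ ⊆ N be a cl-adapted CP-subnet, let μ be a reachable marking of (N,μ₀), and let μ →σ_sd→ μ_sd be the firing of a shutdown sequence for N̂ at μ. Then μ_sd(p) = 0 for every place p of N̂. -/

import Mathlib

open Classical

/-- A (finite, bipartite) Petri *net*: disjoint finite sets of places and
transitions, and an edge relation running only between places and transitions. -/
structure Net (α : Type*) where
  places : Finset α
  transitions : Finset α
  F : α → α → Prop
  disj : Disjoint places transitions
  edges : ∀ x y, F x y →
    (x ∈ places ∧ y ∈ transitions) ∨ (x ∈ transitions ∧ y ∈ places)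

namespace Net

variable {α : Type*} [DecidableEq α]

/-- The nodes of a net. -/
def nodes (N : Net α) : Finset α := N.places ∪ N.transitions

/-- Pre-set of a node. -/
def pre (N : Net α) (x : α) : Set α := {y | N.F y x}

/-- Post-set of a node. -/
def post (N : Net α) (x : α) : Set α := {y | N.F x y}

/-- A transition `t` is enabled at a marking `μ` if every pre-place is marked. -/
def Enabled (N : Net α) (μ : α → ℕ) (t : α) : Prop :=
  t ∈ N.transitions ∧ ∀ p, N.F p t → 1 ≤ μ p

/-- Firing a transition: remove one token from each pre-place,
add one token at each post-place. -/
noncomputable def fire (N : Net α) (t : α) (μ : α → ℕ) : α → ℕ :=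
  fun p => μ p - (if N.F p t then 1 else 0) + (if N.F t p then 1 else 0)

/-- `FireSeq N μ σ ν`: the occurrence sequence `σ` is enabled at `μ` and
firing it successively leads from `μ` to `ν`. -/
inductive FireSeq (N : Net α) : (α → ℕ) → List α → (α → ℕ) → Prop
  | nil (μ : α → ℕ) : FireSeq N μ [] μ
  | cons {μ ν : α → ℕ} {t : α} {σ : List α} :
      N.Enabled μ t → FireSeq N (N.fire t μ) σ ν → FireSeq N μ (t :: σ) ν

/-- Reachability of markings. -/
def Reach (N : Net α) (μ ν : α → ℕ) : Prop := ∃ σ : List α, N.FireSeq μ σ ν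

/-- The set of transitions enabled at `μ`. -/
def en (N : Net α) (μ : α → ℕ) : Set α := {t | N.Enabled μ t}

/-- Equality of markings (as maps on the places of the net). -/
def MarkingEq (N : Net α) (μ ν : α → ℕ) : Prop := ∀ p ∈ N.places, μ p = ν p

/-- Liveness of a Petri net `(N, μ₀)`. -/
def Live (N : Net α) (μ₀ : α → ℕ) : Prop :=
  ∀ t ∈ N.transitions, ∀ μ, N.Reach μ₀ μ → ∃ ν, N.Reach μ ν ∧ N.Enabled ν t

/-- Boundedness of a Petri net `(N, μ₀)`. -/
def Bounded (N : Net α) (μ₀ : α → ℕ) : Prop :=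
  ∃ K : ℕ, ∀ μ, N.Reach μ₀ μ → ∀ p ∈ N.places, μ p ≤ K

/-- A net is well-formed if it carries a live and bounded marking. -/
def WellFormed (N : Net α) : Prop := ∃ μ₀ : α → ℕ, N.Live μ₀ ∧ N.Bounded μ₀

/-- Free-choice net: `(p,t) ∈ F` implies `•t × p• ⊆ F`. -/
def FreeChoice (N : Net α) : Prop :=
  ∀ p ∈ N.places, ∀ t, N.F p t → ∀ p', N.F p' t → ∀ t', N.F p t' → N.F p' t'

/-- T-net: every place has exactly one pre-transition and one post-transition. -/
def IsTNet (N : Net α) : Prop :=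
  ∀ p ∈ N.places, (∃! t, N.F t p) ∧ (∃! t, N.F p t)

/-- A set of nodes is cluster-closed if with each place it contains the
post-set of the place and with each transition the pre-set of the transition. -/
def ClusterClosed (N : Net α) (S : Set α) : Prop :=
  (∀ p ∈ S, p ∈ N.places → ∀ t, N.F p t → t ∈ S) ∧
  (∀ t ∈ S, t ∈ N.transitions → ∀ p, N.F p t → p ∈ S)

/-- The cluster of a node: the smallest cluster-closed set of nodes containing it. -/
def clusterOf (N : Net α) (x : α) : Set α :=
  ⋂₀ {S : Set α | x ∈ S ∧ N.ClusterClosed S}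

/-- `cl` is a cluster of `N` if it is the cluster of some node. -/
def IsCluster (N : Net α) (cl : Set α) : Prop :=
  ∃ x ∈ N.nodes, cl = N.clusterOf x

/-- The marking `μ_cl` marking exactly the places of the cluster `cl`, once. -/
noncomputable def clusterMarking (N : Net α) (cl : Set α) : α → ℕ :=
  fun p => if p ∈ cl ∧ p ∈ N.places then 1 else 0

/-- `μh` is a home marking of `(N, μ₀)`: reachable from every reachable marking. -/
def IsHomeMarking (N : Net α) (μ₀ μh : α → ℕ) : Prop :=
  ∀ μ, N.Reach μ₀ μ → ∃ ν, N.Reach μ ν ∧ N.MarkingEq ν μh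

/-- `(N, μ₀)` is perpetual with regeneration cluster `cl`: live, bounded, and
`μ_cl` is a home marking for the cluster `cl`. -/
def Perpetual (N : Net α) (μ₀ : α → ℕ) (cl : Set α) : Prop :=
  N.Live μ₀ ∧ N.Bounded μ₀ ∧ N.IsCluster cl ∧
    N.IsHomeMarking μ₀ (N.clusterMarking cl)

/-- Lucency: enabling-equivalent reachable markings are equal. -/
def Lucent (N : Net α) (μ₀ : α → ℕ) : Prop :=
  ∀ μ₁ μ₂, N.Reach μ₀ μ₁ → N.Reach μ₀ μ₂ → N.en μ₁ = N.en μ₂ → N.MarkingEq μ₁ μ₂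

/-- A path of the net: a nonempty sequence of nodes along edges. -/
def IsPath (N : Net α) (δ : List α) : Prop :=
  δ ≠ [] ∧ (∀ x ∈ δ, x ∈ N.nodes) ∧ δ.Chain' N.F

/-- A circuit: a path whose last node is connected back to its first node. -/
def IsCircuit (N : Net α) (δ : List α) : Prop :=
  N.IsPath δ ∧ ∃ h : δ ≠ [], N.F (δ.getLast h) (δ.head h)

/-- Token count of a set of nodes: total number of tokens on its places. -/
def tokenCount (N : Net α) (μ : α → ℕ) (X : Finset α) : ℕ :=
  ∑ p ∈ X ∩ N.places, μ p

/-- The set `S` of nodes is strongly connected (in the induced subnet). -/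
def StronglyConnectedOn (N : Net α) (S : Finset α) : Prop :=
  ∀ x ∈ S, ∀ y ∈ S,
    Relation.ReflTransGen (fun a b => a ∈ S ∧ b ∈ S ∧ N.F a b) x y

/-- The set `S` of nodes is weakly connected (in the induced subnet). -/
def WeaklyConnectedOn (N : Net α) (S : Finset α) : Prop :=
  ∀ x ∈ S, ∀ y ∈ S,
    Relation.ReflTransGen (fun a b => a ∈ S ∧ b ∈ S ∧ (N.F a b ∨ N.F b a)) x y

/-- The (full) subnet spanned by `S` is transition-bordered: every place of `S`
has all its neighbours inside `S`. -/
def TransitionBordered (N : Net α) (S : Finset α) : Prop :=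
  ∀ p ∈ S, p ∈ N.places → ∀ y, (N.F y p ∨ N.F p y) → y ∈ S

/-- The full subnet spanned by `S` is a T-net: each place of `S` has exactly one
pre-transition and one post-transition inside `S`. -/
def TNetOn (N : Net α) (S : Finset α) : Prop :=
  ∀ p ∈ S, p ∈ N.places →
    (∃! t, t ∈ S ∧ N.F t p) ∧ (∃! t, t ∈ S ∧ N.F p t)

/-- `S` spans a CP-subnet of `N`: nonempty, weakly connected, transition-bordered,
a T-net, and the complement contains a transition and is strongly connected. -/
def IsCPSubnet (N : Net α) (S : Finset α) : Prop :=
  S.Nonempty ∧ S ⊆ N.nodes ∧ N.WeaklyConnectedOn S ∧ N.TransitionBordered S ∧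
  N.TNetOn S ∧ ((N.nodes \ S) ∩ N.transitions).Nonempty ∧
  N.StronglyConnectedOn (N.nodes \ S)

/-- The full subnet of `N` spanned by the node set `S`, as a net. -/
def restrict (N : Net α) (S : Finset α) : Net α where
  places := N.places ∩ S
  transitions := N.transitions ∩ S
  F := fun x y => x ∈ S ∧ y ∈ S ∧ N.F x y
  disj := N.disj.mono Finset.inter_subset_left Finset.inter_subset_left
  edges := by
    rintro x y ⟨hx, hy, hF⟩
    rcases N.edges x y hF with ⟨h1, h2⟩ | ⟨h1, h2⟩
    · exact Or.inl ⟨Finset.mem_inter.mpr ⟨h1, hx⟩, Finset.mem_inter.mpr ⟨h2, hy⟩⟩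
    · exact Or.inr ⟨Finset.mem_inter.mpr ⟨h1, hx⟩, Finset.mem_inter.mpr ⟨h2, hy⟩⟩

/-- A CP-exhaustion: a family of pairwise disjoint CP-subnets whose complement
is a strongly connected T-net. -/
def IsCPExhaustion (N : Net α) {n : ℕ}
    (Nhat : Fin n → Finset α) : Prop :=
  (∀ i, N.IsCPSubnet (Nhat i)) ∧
  (∀ i j, i ≠ j → Disjoint (Nhat i) (Nhat j)) ∧
  N.StronglyConnectedOn (N.nodes \ Finset.univ.biUnion Nhat) ∧
  N.TNetOn (N.nodes \ Finset.univ.biUnion Nhat)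

/-- `t` is a way-in transition of the subnet spanned by `S`: a transition of `S`
with a pre-place outside `S`. -/
def IsWayIn (N : Net α) (S : Finset α) (t : α) : Prop :=
  t ∈ S ∧ t ∈ N.transitions ∧ ∃ p ∈ N.places, p ∉ S ∧ N.F p t

/-- A shutdown sequence for the subnet spanned by `S` (with way-in transition
`tin`) at a marking `μ`: an occurrence sequence enabled at `μ` using only
transitions of `S` other than `tin`, after which no transition of `S` other
than (possibly) `tin` is enabled. -/
def IsShutdownSeq (N : Net α) (S : Finset α) (tin : α)
    (μ : α → ℕ) (σ : List α) (μsd : α → ℕ) : Prop :=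
  N.FireSeq μ σ μsd ∧
  (∀ t ∈ σ, t ∈ S ∧ t ∈ N.transitions ∧ t ≠ tin) ∧
  (∀ t ∈ S, t ∈ N.transitions → t ≠ tin → ¬ N.Enabled μsd t)

/-- `C` spans a P-component of `N`: nonempty, strongly connected, inside `C`
every transition has exactly one pre-place and one post-place, and every place
of `C` has all its neighbours inside `C`. -/
def IsPComponent (N : Net α) (C : Finset α) : Prop :=
  C.Nonempty ∧ C ⊆ N.nodes ∧ N.StronglyConnectedOn C ∧
  (∀ t ∈ C, t ∈ N.transitions →
    (∃! p, p ∈ C ∧ N.F p t) ∧ (∃! p, p ∈ C ∧ N.F t p)) ∧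
  (∀ p ∈ C, p ∈ N.places → ∀ y, (N.F y p ∨ N.F p y) → y ∈ C)

end Net

namespace Net

variable {α : Type*} {N : Net α}

lemma transition_of_place_edge {p t : α} (hp : p ∈ N.places) (h : N.F p t) :
    t ∈ N.transitions := by
  rcases N.edges _ _ h with h' | h'
  · exact h'.2
  · exact absurd h'.1 (Finset.disjoint_left.1 N.disj hp)

lemma transition_of_edge_place {p t : α} (hp : p ∈ N.places) (h : N.F t p) :
    t ∈ N.transitions := by
  rcases N.edges _ _ h with h' | h'
  · exact absurd h'.2 (Finset.disjoint_left.1 N.disj hp)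
  · exact h'.1

lemma place_of_edge_transition {p t : α} (ht : t ∈ N.transitions) (h : N.F p t) :
    p ∈ N.places := by
  rcases N.edges _ _ h with h' | h'
  · exact h'.1
  · exact absurd ht (Finset.disjoint_left.1 N.disj h'.2)

lemma place_of_transition_edge {p t : α} (ht : t ∈ N.transitions) (h : N.F t p) :
    p ∈ N.places := by
  rcases N.edges _ _ h with h' | h'
  · exact absurd ht (Finset.disjoint_left.1 N.disj h'.1)
  · exact h'.2

lemma FireSeq.append {μ ν ξ : α → ℕ} {σ τ : List α} (h₁ : N.FireSeq μ σ ν)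
    (h₂ : N.FireSeq ν τ ξ) : N.FireSeq μ (σ ++ τ) ξ := by
  induction h₁ with
  | nil μ => exact h₂
  | cons he _ ih => exact FireSeq.cons he (ih h₂)

lemma Enabled.fireSeq {μ : α → ℕ} {t : α} (h : N.Enabled μ t) :
    N.FireSeq μ [t] (N.fire t μ) :=
  FireSeq.cons h (FireSeq.nil _)

lemma Reach.trans {μ ν ξ : α → ℕ} (h₁ : N.Reach μ ν) (h₂ : N.Reach ν ξ) :
    N.Reach μ ξ := by
  obtain ⟨σ, hσ⟩ := h₁
  obtain ⟨τ, hτ⟩ := h₂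
  exact ⟨σ ++ τ, hσ.append hτ⟩

/-- Token balance at a place with a single input and a single output transition. -/
lemma FireSeq.balance [DecidableEq α] {q a b : α} (ha : ∀ t, N.F t q ↔ t = a) (hb : ∀ t, N.F q t ↔ t = b)
    {μ ν : α → ℕ} {σ : List α} (h : N.FireSeq μ σ ν) :
    ν q + σ.count b = μ q + σ.count a := by
  induction h with
  | nil μ => simp
  | @cons μ ν t σ he _ ih =>
    have h1 := he.2 q
    simp only [fire, ha, hb, List.count_cons, beq_iff_eq] at *
    split_ifs at * <;> simp_all <;> omega

/-- An unmarked siphon stays unmarked. -/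
lemma FireSeq.siphon_unmarked {Q : Set α} (hQ : ∀ q ∈ Q, ∀ t, N.F t q → ∃ q' ∈ Q, N.F q' t)
    {μ ν : α → ℕ} {σ : List α} (h : N.FireSeq μ σ ν) (h0 : ∀ q ∈ Q, μ q = 0) :
    ∀ q ∈ Q, ν q = 0 := by
  induction h with
  | nil μ => exact h0
  | @cons μ ν t σ he _ ih =>
    refine ih fun q hq => ?_
    have hnot : ¬ N.F t q := by
      intro htq
      obtain ⟨q', hq', hF⟩ := hQ q hq t htq
      have := he.2 q' hF
      have := h0 q' hq'
      omega
    simp [fire, hnot, h0 q hq]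

/-- Along a sequence that fires no output transition of `q`, the tokens on `q` do not decrease. -/
lemma FireSeq.le_of_no_consumer {q : α} {μ ν : α → ℕ} {σ : List α} (h : N.FireSeq μ σ ν)
    (hσ : ∀ t ∈ σ, ¬ N.F q t) : μ q ≤ ν q := by
  induction h with
  | nil μ => exact le_rfl
  | @cons μ ν t σ he _ ih =>
    refine le_trans ?_ (ih fun t' ht' => hσ t' (List.mem_cons_of_mem _ ht'))
    simp [fire, hσ t List.mem_cons_self]

/-- In a free-choice net, transitions sharing a pre-place are enabled together. -/
lemma FreeChoice.enabled_of_conflict (hfc : N.FreeChoice) {p t t' : α} (hp : p ∈ N.places)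
    (ht : N.F p t) (ht' : N.F p t') {μ : α → ℕ} (h : N.Enabled μ t) : N.Enabled μ t' :=
  ⟨transition_of_place_edge hp ht',
    fun p' hp' => h.2 p' (hfc p hp t' ht' p' hp' t ht)⟩

/-- A live net with a transition has an enabled transition at every reachable marking. -/
lemma Live.exists_enabled {μ₀ μ : α → ℕ} (hl : N.Live μ₀) (hμ : N.Reach μ₀ μ) {t : α}
    (ht : t ∈ N.transitions) : ∃ u, N.Enabled μ u := by
  obtain ⟨ν, ⟨σ, hσ⟩, hν⟩ := hl t ht μ hμ
  cases hσ with
  | nil => exact ⟨t, hν⟩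
  | cons he _ => exact ⟨_, he⟩

/-- Reachability by transitions outside the node set `S`. -/
def OuterReach (N : Net α) (S : Finset α) (μ ν : α → ℕ) : Prop :=
  ∃ σ : List α, N.FireSeq μ σ ν ∧ ∀ t ∈ σ, t ∉ S

/-- The transition `t` is never enabled after firing transitions outside `S`. -/
def OuterDead (N : Net α) (S : Finset α) (μ : α → ℕ) (t : α) : Prop :=
  ∀ ν, N.OuterReach S μ ν → ¬ N.Enabled ν t

section OuterReach

variable {S : Finset α} {μ ν ξ : α → ℕ}

lemma OuterReach.refl (N : Net α) (S : Finset α) (μ : α → ℕ) : N.OuterReach S μ μ :=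
  ⟨[], FireSeq.nil μ, by simp⟩

lemma OuterReach.trans (h₁ : N.OuterReach S μ ν) (h₂ : N.OuterReach S ν ξ) :
    N.OuterReach S μ ξ := by
  obtain ⟨σ, hσ, hσS⟩ := h₁
  obtain ⟨τ, hτ, hτS⟩ := h₂
  refine ⟨σ ++ τ, hσ.append hτ, fun t ht => ?_⟩
  rcases List.mem_append.1 ht with h | h
  · exact hσS t h
  · exact hτS t h

lemma OuterReach.reach (h : N.OuterReach S μ ν) : N.Reach μ ν :=
  ⟨h.choose, h.choose_spec.1⟩

lemma OuterReach.of_enabled {t : α} (h : N.Enabled μ t) (ht : t ∉ S) :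
    N.OuterReach S μ (N.fire t μ) :=
  ⟨[t], h.fireSeq, by simpa using ht⟩

lemma OuterDead.mono {t : α} (h : N.OuterDead S μ t) (hν : N.OuterReach S μ ν) :
    N.OuterDead S ν t :=
  fun _ hξ => h _ (hν.trans hξ)

lemma OuterDead.le {q : α} (h : ∀ t, N.F q t → N.OuterDead S μ t) (hν : N.OuterReach S μ ν) :
    μ q ≤ ν q := by
  obtain ⟨σ, hσ, hσS⟩ := hν
  refine hσ.le_of_no_consumer fun t ht hF => ?_
  induction hσ with
  | nil => simp at ht
  | @cons μ ν u σ he _ ih =>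
    have huS := hσS u List.mem_cons_self
    rcases List.mem_cons.1 ht with rfl | ht
    · exact h t hF μ (OuterReach.refl N S μ) he
    · exact ih (fun t hF => (h t hF).mono (OuterReach.of_enabled he huS))
        (fun t ht => hσS t (List.mem_cons_of_mem _ ht)) ht

/-- After some sequence outside `S` no further transition can become dead. -/
lemma exists_outerReach_stable (N : Net α) (S : Finset α) (μ : α → ℕ) :
    ∃ ν, N.OuterReach S μ ν ∧ ∀ ξ, N.OuterReach S ν ξ → ∀ t ∈ N.transitions,
      N.OuterDead S ξ t → N.OuterDead S ν t := by
  let f : (α → ℕ) → ℕ := fun ν => (N.transitions.filter fun t => ¬ N.OuterDead S ν t).card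
  obtain ⟨ν, hν, hmin⟩ := (InvImage.wf f wellFounded_lt).has_min
    {ν | N.OuterReach S μ ν} ⟨μ, OuterReach.refl N S μ⟩
  refine ⟨ν, hν, fun ξ hξ t ht hdead => ?_⟩
  by_contra hlive
  refine hmin ξ (hν.trans hξ) (Finset.card_lt_card ?_)
  rw [Finset.ssubset_iff_of_subset]
  · exact ⟨t, by simp [ht, hlive], by simp [hdead]⟩
  · intro u hu
    simp only [Finset.mem_filter] at hu ⊢
    exact ⟨hu.1, fun h => hu.2 (h.mono hξ)⟩

/-- If all output transitions of a bounded place are dead, its input transitions die eventually. -/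
lemma outerDead_input {μ₀ : α → ℕ} (hb : N.Bounded μ₀) (hμ : N.Reach μ₀ μ)
    (hstable : ∀ ξ, N.OuterReach S μ ξ → ∀ t ∈ N.transitions,
      N.OuterDead S ξ t → N.OuterDead S μ t)
    {q u : α} (hq : q ∈ N.places) (hu : N.F u q) (huS : u ∉ S)
    (hdead : ∀ t, N.F q t → N.OuterDead S μ t) : N.OuterDead S μ u := by
  by_contra hlive
  have huT := transition_of_edge_place hq hu
  obtain ⟨K, hK⟩ := hb
  have key : ∀ n : ℕ, ∃ ν, N.OuterReach S μ ν ∧ n ≤ ν q := by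
    intro n
    induction n with
    | zero => exact ⟨μ, OuterReach.refl N S μ, Nat.zero_le _⟩
    | succ n ih =>
      obtain ⟨ν, hν, hn⟩ := ih
      have h1 : ¬ N.OuterDead S ν u := fun h => hlive (hstable ν hν u huT h)
      simp only [OuterDead, not_forall, not_not] at h1
      obtain ⟨ξ, hξ, he⟩ := h1
      have h2 := OuterDead.le (fun t ht => (hdead t ht).mono hν) hξ
      have h3 : ¬ N.F q u := fun h => hlive (hdead u h)
      refine ⟨N.fire u ξ, (hν.trans hξ).trans (OuterReach.of_enabled he huS), ?_⟩
      simp only [fire, h3, hu, if_true, if_false]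
      omega
  obtain ⟨ν, hν, hn⟩ := key (K + 1)
  have := hK ν (hμ.trans hν.reach) q hq
  omega

end OuterReach

section CPSubnet

variable [DecidableEq α] {S : Finset α} {μ₀ : α → ℕ}

/-- A place of a CP-subnet has one input and one output transition in the whole net,
both in the subnet. -/
lemma IsCPSubnet.exists_input_output (hS : N.IsCPSubnet S) {p : α} (hpS : p ∈ S)
    (hp : p ∈ N.places) :
    ∃ a ∈ S, ∃ b ∈ S, a ∈ N.transitions ∧ b ∈ N.transitions ∧
      (∀ t, N.F t p ↔ t = a) ∧ (∀ t, N.F p t ↔ t = b) := by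
  obtain ⟨-, -, -, htb, htn, -, -⟩ := hS
  obtain ⟨⟨a, ⟨haS, ha⟩, hau⟩, ⟨b, ⟨hbS, hb⟩, hbu⟩⟩ := htn p hpS hp
  refine ⟨a, haS, b, hbS, transition_of_edge_place hp ha, transition_of_place_edge hp hb,
    fun t => ⟨fun h => hau t ⟨htb p hpS hp t (Or.inl h), h⟩, ?_⟩,
    fun t => ⟨fun h => hbu t ⟨htb p hpS hp t (Or.inr h), h⟩, ?_⟩⟩
  · rintro rfl; exact ha
  · rintro rfl; exact hb

lemma IsCPSubnet.exists_outer_output (hS : N.IsCPSubnet S) {r : α} (hr : r ∈ N.places)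
    (hrS : r ∉ S) : ∃ u ∉ S, N.F r u := by
  obtain ⟨-, -, -, -, -, ⟨x, hx⟩, hsc⟩ := hS
  rw [Finset.mem_inter] at hx
  have hrc : r ∈ N.nodes \ S := by simp [nodes, hr, hrS]
  rcases (hsc r hrc x hx.1).cases_head with h | ⟨u, ⟨-, huS, hF⟩, -⟩
  · exact absurd hx.2 (h ▸ Finset.disjoint_left.1 N.disj hr)
  · exact ⟨u, (Finset.mem_sdiff.1 huS).2, hF⟩

/-- A way-in transition is in conflict with a transition outside the subnet. -/
lemma IsCPSubnet.exists_conflict_of_isWayIn (hS : N.IsCPSubnet S) {t : α}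
    (ht : N.IsWayIn S t) : ∃ r ∈ N.places, r ∉ S ∧ N.F r t ∧ ∃ u ∉ S, N.F r u := by
  obtain ⟨-, -, r, hr, hrS, hF⟩ := ht
  exact ⟨r, hr, hrS, hF, hS.exists_outer_output hr hrS⟩

/-- In a free-choice net, no place of a CP-subnet feeds a way-in transition. -/
lemma IsCPSubnet.not_edge_isWayIn (hS : N.IsCPSubnet S) (hfc : N.FreeChoice) {p t : α}
    (hpS : p ∈ S) (hp : p ∈ N.places) (ht : N.IsWayIn S t) : ¬ N.F p t := by
  intro hF
  obtain ⟨r, hr, -, hrt, u, huS, hru⟩ := hS.exists_conflict_of_isWayIn ht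
  exact huS (hS.2.2.2.1 p hpS hp u (Or.inr (hfc r hr t hrt p hF u hru)))

/-- A cluster that is not contained in a CP-subnet contains none of its places. -/
lemma IsCPSubnet.not_mem_cluster (hS : N.IsCPSubnet S) (hfc : N.FreeChoice) {cl : Set α}
    (hcl : N.IsCluster cl) (had : ¬ cl ⊆ (S : Set α)) {p : α} (hpS : p ∈ S)
    (hp : p ∈ N.places) : p ∉ cl := by
  obtain ⟨x, -, rfl⟩ := hcl
  let Y : Set α := {y | y ∈ S ∧ ¬ N.IsWayIn S y}
  have hout : ∀ q ∈ Y, q ∈ N.places → ∀ t, N.F q t → t ∈ Y := fun q hq hqp t hF =>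
    ⟨hS.2.2.2.1 q hq.1 hqp t (Or.inr hF), fun hw => hS.not_edge_isWayIn hfc hq.1 hqp hw hF⟩
  have hin : ∀ t ∈ Y, t ∈ N.transitions → ∀ q, N.F q t → q ∈ Y := by
    intro t ht htT q hF
    have hqp := place_of_edge_transition htT hF
    refine ⟨?_, fun hw => Finset.disjoint_left.1 N.disj hqp hw.2.1⟩
    by_contra hqS
    exact ht.2 ⟨ht.1, htT, q, hqp, hqS, hF⟩
  by_cases hx : x ∈ Y
  · have hsub : N.clusterOf x ⊆ Y := Set.sInter_subset_of_mem ⟨hx, hout, hin⟩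
    exact absurd (hsub.trans fun y hy => hy.1) had
  · intro hmem
    have hclosed : N.ClusterClosed Yᶜ :=
      ⟨fun q hq hqp t hF ht => hq (hin t ht (transition_of_place_edge hqp hF) q hF),
        fun t ht htT q hF hq => ht (hout q hq (place_of_edge_transition htT hF) t hF)⟩
    have hsub : N.clusterOf x ⊆ Yᶜ := Set.sInter_subset_of_mem ⟨hx, hclosed⟩
    exact hsub hmem ⟨hpS, fun hw => Finset.disjoint_left.1 N.disj hp hw.2.1⟩

/-- In a bounded net the firing counts of the transitions of a CP-subnet stay close. -/
lemma IsCPSubnet.exists_count_le (hS : N.IsCPSubnet S) (hb : N.Bounded μ₀) {s t : α}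
    (hsS : s ∈ S) (hsT : s ∈ N.transitions) (htS : t ∈ S) (htT : t ∈ N.transitions) :
    ∃ B : ℕ, ∀ σ ν, N.FireSeq μ₀ σ ν → σ.count t ≤ σ.count s + B := by
  obtain ⟨K, hK⟩ := hb
  let close : α → Prop := fun t =>
    ∃ B : ℕ, ∀ σ ν, N.FireSeq μ₀ σ ν → σ.count t ≤ σ.count s + B
  suffices h : (t ∈ N.transitions → close t) ∧
      (t ∈ N.places → ∀ u, (N.F t u ∨ N.F u t) → close u) from h.1 htT
  have hpath := hS.2.2.1 s hsS t htS
  clear htT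
  induction hpath with
  | refl =>
    exact ⟨fun _ => ⟨0, fun σ ν _ => le_rfl⟩,
      fun h => absurd hsT (Finset.disjoint_left.1 N.disj h)⟩
  | @tail x y _ hstep ih =>
    obtain ⟨hxS, hyS, hF⟩ := hstep
    specialize ih hxS
    constructor
    · intro hyT
      have hxp : x ∈ N.places := by
        rcases hF with h | h
        · exact place_of_edge_transition hyT h
        · exact place_of_transition_edge hyT h
      exact ih.2 hxp y hF
    · intro hyp u hu
      have hxT : x ∈ N.transitions := by
        rcases hF with h | h
        · exact transition_of_edge_place hyp h
        · exact transition_of_place_edge hyp h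
      obtain ⟨B, hB⟩ := ih.1 hxT
      obtain ⟨a, -, b, -, -, -, ha, hb⟩ := hS.exists_input_output hyS hyp
      have hxab : x = a ∨ x = b := hF.imp (ha x).1 (hb x).1
      have huab : u = b ∨ u = a := hu.imp (hb u).1 (ha u).1
      refine ⟨B + K + μ₀ y, fun σ ν hσ => ?_⟩
      have h1 := hB σ ν hσ
      have h2 := hσ.balance ha hb
      have h3 := hK ν ⟨σ, hσ⟩ y hyp
      rcases hxab with rfl | rfl <;> rcases huab with rfl | rfl <;> omega

/-- In a live and bounded free-choice net, given two way-in transitions, from every reachable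
marking one can enable a transition of the subnet other than `t₂` without firing the subnet. -/
lemma IsCPSubnet.exists_outerReach_enabled (hS : N.IsCPSubnet S) (hfc : N.FreeChoice)
    (hl : N.Live μ₀) (hb : N.Bounded μ₀) {t₁ t₂ : α} (h₁ : N.IsWayIn S t₁)
    (h₂ : N.IsWayIn S t₂) (hne : t₁ ≠ t₂) {μ : α → ℕ} (hμ : N.Reach μ₀ μ) :
    ∃ ν, N.OuterReach S μ ν ∧ ∃ t ∈ S, t ≠ t₂ ∧ N.Enabled ν t := by
  by_contra! hcon
  obtain ⟨r₁, hr₁, -, hrt₁, u₁, hu₁S, hru₁⟩ := hS.exists_conflict_of_isWayIn h₁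
  obtain ⟨r₂, hr₂, -, hrt₂, u₂, hu₂S, hru₂⟩ := hS.exists_conflict_of_isWayIn h₂
  obtain ⟨M, hM, hstable⟩ := exists_outerReach_stable N S μ
  have hMr := hμ.trans hM.reach
  have hu₁ : N.OuterDead S M u₁ := fun ν hν he =>
    hcon ν (hM.trans hν) t₁ h₁.1 hne (hfc.enabled_of_conflict hr₁ hru₁ hrt₁ he)
  have hnode : ∀ {t}, t ∈ N.transitions → t ∉ S → t ∈ N.nodes \ S := fun ht htS => by
    simp [nodes, ht, htS]
  have hu₁T := transition_of_place_edge hr₁ hru₁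
  have hall : ∀ t ∈ N.transitions, t ∉ S → N.OuterDead S M t := by
    intro t ht htS
    have hpath := hS.2.2.2.2.2.2 t (hnode ht htS) u₁ (hnode hu₁T hu₁S)
    suffices h : (t ∈ N.transitions → N.OuterDead S M t) ∧
        (t ∈ N.places → ∃ u, N.F t u ∧ N.OuterDead S M u) from h.1 ht
    clear ht htS
    induction hpath using Relation.ReflTransGen.head_induction_on with
    | refl => exact ⟨fun _ => hu₁, fun h => absurd hu₁T (Finset.disjoint_left.1 N.disj h)⟩
    | @head x y hstep _ ih =>
      obtain ⟨hx, -, hF⟩ := hstep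
      refine ⟨fun hxT => ?_, fun hxp => ⟨y, hF, ih.1 (transition_of_place_edge hxp hF)⟩⟩
      have hyp := place_of_transition_edge hxT hF
      obtain ⟨u, hyu, hu⟩ := ih.2 hyp
      exact outerDead_input hb hMr hstable hyp hF (Finset.mem_sdiff.1 hx).2
        fun t ht ν hν he => hu ν hν (hfc.enabled_of_conflict hyp ht hyu he)
  have hdead : ∀ t, t ∉ S → ¬ N.Enabled M t := fun t htS he =>
    hall t he.1 htS M (OuterReach.refl N S M) he
  obtain ⟨u, hu⟩ := hl.exists_enabled hMr hu₁T
  by_cases huS : u ∈ S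
  · by_cases hu₂ : u = t₂
    · subst hu₂
      exact hdead u₂ hu₂S (hfc.enabled_of_conflict hr₂ hrt₂ hru₂ hu)
    · exact hcon M hM u huS hu₂ hu
  · exact hdead u huS hu

/-- A CP-subnet of a live and bounded free-choice net has at most one way-in transition. -/
lemma IsCPSubnet.isWayIn_unique (hS : N.IsCPSubnet S) (hfc : N.FreeChoice)
    (hl : N.Live μ₀) (hb : N.Bounded μ₀) {t₁ t₂ : α} (h₁ : N.IsWayIn S t₁)
    (h₂ : N.IsWayIn S t₂) : t₁ = t₂ := by
  by_contra hne
  have hbound : ∀ t, ∃ B : ℕ, t ∈ S ∩ N.transitions → ∀ σ ν, N.FireSeq μ₀ σ ν →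
      σ.count t ≤ σ.count t₂ + B := by
    intro t
    by_cases ht : t ∈ S ∩ N.transitions
    · rw [Finset.mem_inter] at ht
      obtain ⟨B, hB⟩ := hS.exists_count_le hb h₂.1 h₂.2.1 ht.1 ht.2
      exact ⟨B, fun _ => hB⟩
    · exact ⟨0, fun h => absurd h ht⟩
  choose B hB using hbound
  have key : ∀ n : ℕ, ∃ σ ν, N.FireSeq μ₀ σ ν ∧ t₂ ∉ σ ∧
      n ≤ ∑ t ∈ S ∩ N.transitions, σ.count t := by
    intro n
    induction n with
    | zero => exact ⟨[], μ₀, FireSeq.nil _, by simp, Nat.zero_le _⟩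
    | succ n ih =>
      obtain ⟨σ, ν, hσ, h2, hn⟩ := ih
      obtain ⟨ξ, ⟨τ, hτ, hτS⟩, t, htS, htne, he⟩ :=
        hS.exists_outerReach_enabled hfc hl hb h₁ h₂ hne ⟨σ, hσ⟩
      refine ⟨σ ++ τ ++ [t], _, (hσ.append hτ).append he.fireSeq, ?_, ?_⟩
      · simp only [List.mem_append, List.mem_singleton, not_or]
        exact ⟨⟨h2, fun h => hτS _ h h₂.1⟩, htne.symm⟩
      · refine lt_of_le_of_lt hn (Finset.sum_lt_sum (fun u _ => ?_)
          ⟨t, Finset.mem_inter.2 ⟨htS, he.1⟩, ?_⟩)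
        · rw [List.append_assoc, List.count_append]
          exact Nat.le_add_right _ _
        · simp only [List.count_append, List.count_singleton_self]
          omega
  obtain ⟨σ, ν, hσ, h2, hn⟩ := key (∑ t ∈ S ∩ N.transitions, B t + 1)
  have hle : ∑ t ∈ S ∩ N.transitions, σ.count t ≤ ∑ t ∈ S ∩ N.transitions, B t :=
    Finset.sum_le_sum fun t ht => by
      simpa [List.count_eq_zero_of_not_mem h2] using hB t ht σ ν hσ
  omega

end CPSubnet

end Net

/-- **Shutdown empties an adapted CP-subnet.** Let `(N, μ₀)` be a perpetual
free-choice system with regeneration cluster `cl`, let `S` span a `cl`-adapted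
CP-subnet with way-in transition `tin`, let `μ` be a reachable marking and let
`μ →σ→ μ_sd` fire a shutdown sequence for the subnet at `μ`. Then `μ_sd`
leaves every place of the subnet unmarked. -/
theorem shutdown_empties_adapted_cpSubnet
    {α : Type*} [DecidableEq α] (N : Net α) (μ₀ : α → ℕ) (cl : Set α)
    (hfc : N.FreeChoice) (hperp : N.Perpetual μ₀ cl)
    (S : Finset α) (hS : N.IsCPSubnet S) (had : ¬ cl ⊆ (S : Set α))
    (tin : α) (htin : N.IsWayIn S tin)
    (μ : α → ℕ) (hμ : N.Reach μ₀ μ)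
    (σ : List α) (μsd : α → ℕ) (hsd : N.IsShutdownSeq S tin μ σ μsd) :
    ∀ p ∈ S, p ∈ N.places → μsd p = 0 := by
  obtain ⟨hl, hb, hcl, hhome⟩ := hperp
  obtain ⟨hσ, -, hdis⟩ := hsd
  have hsdr : N.Reach μ₀ μsd := hμ.trans ⟨σ, hσ⟩
  obtain ⟨ν, ⟨τ, hτ⟩, hν⟩ := hhome μsd hsdr
  have hν0 : ∀ q ∈ S, q ∈ N.places → ν q = 0 := fun q hqS hq => by
    rw [hν q hq]
    simp [Net.clusterMarking, hS.not_mem_cluster hfc hcl had hqS hq]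
  let A : Set α := {t | t ∈ S ∧ t ∈ N.transitions ∧ τ.count t ≠ τ.count tin}
  let Q : Set α := {q | (q ∈ S ∧ q ∈ N.places ∧ μsd q = 0) ∧ ∀ a, N.F a q → a ∈ A}
  have hAQ : ∀ t ∈ A, ∃ q ∈ Q, N.F q t := by
    rintro t ⟨htS, htT, hct⟩
    have hne : t ≠ tin := by
      rintro rfl
      exact hct rfl
    have hnen := hdis t htS htT hne
    simp only [Net.Enabled, htT, true_and, not_forall, not_le, Nat.lt_one_iff] at hnen
    obtain ⟨q, hqt, hq0⟩ := hnen
    have hqp := Net.place_of_edge_transition htT hqt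
    have hqS : q ∈ S := by
      by_contra hqS
      exact hne (hS.isWayIn_unique hfc hl hb ⟨htS, htT, q, hqp, hqS, hqt⟩ htin)
    obtain ⟨a, haS, b, -, haT, -, ha, hb'⟩ := hS.exists_input_output hqS hqp
    have hbal := hτ.balance ha hb'
    have h0 := hν0 q hqS hqp
    have htb := (hb' t).1 hqt
    subst htb
    refine ⟨q, ⟨⟨hqS, hqp, hq0⟩, fun a' ha' => ?_⟩, hqt⟩
    rw [(ha a').1 ha']
    exact ⟨haS, haT, by omega⟩
  have hconst : ∀ t ∈ S, t ∈ N.transitions → τ.count t = τ.count tin := by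
    intro t htS htT
    by_contra hct
    obtain ⟨q, hqQ, hqt⟩ := hAQ t ⟨htS, htT, hct⟩
    obtain ⟨ξ, ⟨ρ, hρ⟩, he⟩ := hl t htT μsd hsdr
    have hz := hρ.siphon_unmarked (Q := Q) (fun q hq u hu => hAQ u (hq.2 u hu))
      (fun q hq => hq.1.2.2) q hqQ
    have := he.2 q hqt
    omega
  intro p hpS hp
  obtain ⟨a, haS, b, hbS, haT, hbT, ha, hb'⟩ := hS.exists_input_output hpS hp
  have hbal := hτ.balance ha hb'
  rw [hν0 p hpS hp, hconst a haS haT, hconst b hbS hbT] at hbal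
  omega
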